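/- arXiv:1305.7305 — 6 statements merged into one kernel-verified Lean document; each statement's English description precedes it below -/
import Mathlib

section
/- Let A be a real m₁×m₂ matrix, set S₁ = [[0, A],[−Aᵀ, 0]] and S₁' = [[0, A],[Aᵀ, 0]] (block matrices of order m = m₁+m₂), and let S₂ be an n×n real skew-symmetric matrix. Then the spectrum of the complex matrix obtained from S₁'⊗S₂ by mapping its entries into ℂ equals the set { i·μ·λ : μ, λ ∈ ℝ, i·μ is a complex eigenvalue of S₁ and i·λ is a complex eigenvalue of S₂ }. -/
open Matrix Kronecker

namespace Matrix

/-- The spectrum of the Kronecker product of two Hermitian matrices consists of the products of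
their eigenvalues. -/
theorem IsHermitian.spectrum_kronecker {𝕜 m n : Type*} [RCLike 𝕜] [Fintype m] [DecidableEq m]
    [Fintype n] [DecidableEq n] {P : Matrix m m 𝕜} {Q : Matrix n n 𝕜}
    (hP : P.IsHermitian) (hQ : Q.IsHermitian) :
    spectrum 𝕜 (P ⊗ₖ Q) =
      Set.range fun p : m × n ↦ (hP.eigenvalues p.1 : 𝕜) * (hQ.eigenvalues p.2 : 𝕜) := by
  let W : unitary (Matrix (m × n) (m × n) 𝕜) :=
    ⟨hP.eigenvectorUnitary.1 ⊗ₖ hQ.eigenvectorUnitary.1,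
      kronecker_mem_unitary hP.eigenvectorUnitary.2 hQ.eigenvectorUnitary.2⟩
  have h : P ⊗ₖ Q = Unitary.conjStarAlgAut 𝕜 _ W
      (diagonal fun p ↦ (hP.eigenvalues p.1 : 𝕜) * (hQ.eigenvalues p.2 : 𝕜)) := by
    conv_lhs => rw [hP.spectral_theorem, hQ.spectral_theorem]
    simp only [Unitary.conjStarAlgAut_apply, mul_kronecker_mul, diagonal_kronecker_diagonal, W,
      star_eq_conjTranspose, conjTranspose_kronecker, Function.comp_apply]
  rw [h, AlgEquiv.spectrum_eq, spectrum_diagonal]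

/-- Conjugation by `diag(1, -I)` turns `[[0, B], [-C, 0]]` into `I` times `[[0, B], [C, 0]]`. -/
theorem spectrum_fromBlocks_neg_eq_spectrum_I_smul {m n : Type*} [Fintype m] [DecidableEq m]
    [Fintype n] [DecidableEq n] (B : Matrix m n ℂ) (C : Matrix n m ℂ) :
    spectrum ℂ (fromBlocks 0 B (-C) 0) = spectrum ℂ (Complex.I • fromBlocks 0 B C 0) := by
  let D : (Matrix (m ⊕ n) (m ⊕ n) ℂ)ˣ :=
    ⟨fromBlocks 1 0 0 (-Complex.I • 1), fromBlocks 1 0 0 (Complex.I • 1),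
      by simp [fromBlocks_multiply, smul_smul], by simp [fromBlocks_multiply, smul_smul]⟩
  have h : Complex.I • fromBlocks 0 B C 0 =
      (D : Matrix (m ⊕ n) (m ⊕ n) ℂ) * fromBlocks 0 B (-C) 0 * (D⁻¹).1 := by
    simp [D, Units.inv_mk, fromBlocks_multiply, fromBlocks_smul]
  rw [h, spectrum.units_conjugate]

end Matrix

theorem spectrum.mem_I_smul_iff {R : Type*} [Ring R] [Algebra ℂ R] {a : R} {z : ℂ} :
    Complex.I * z ∈ spectrum ℂ (Complex.I • a) ↔ z ∈ spectrum ℂ a := by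
  simpa [Units.smul_def] using
    spectrum.smul_mem_smul_iff (R := ℂ) (a := a) (s := z) (r := Units.mk0 _ Complex.I_ne_zero)

theorem kronecker_orientation_spectrum
    (m₁ m₂ n : ℕ) (A : Matrix (Fin m₁) (Fin m₂) ℝ)
    (S₂ : Matrix (Fin n) (Fin n) ℝ) (hskew₂ : S₂ᵀ = -S₂)
    (S₁ : Matrix (Fin m₁ ⊕ Fin m₂) (Fin m₁ ⊕ Fin m₂) ℝ)
    (hS₁ : S₁ = Matrix.fromBlocks 0 A (-Aᵀ) 0)
    (S₁' : Matrix (Fin m₁ ⊕ Fin m₂) (Fin m₁ ⊕ Fin m₂) ℝ)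
    (hS₁' : S₁' = Matrix.fromBlocks 0 A Aᵀ 0) :
    spectrum ℂ ((S₁' ⊗ₖ S₂).map Complex.ofReal) =
      {z : ℂ | ∃ μ lam : ℝ, z = Complex.I * μ * lam ∧
        Complex.I * μ ∈ spectrum ℂ (S₁.map Complex.ofReal) ∧
        Complex.I * lam ∈ spectrum ℂ (S₂.map Complex.ofReal)} := by
  have hP : (S₁'.map Complex.ofReal).IsHermitian := by
    subst hS₁'
    ext i j
    rcases i with i | i <;> rcases j with j | j <;> simp
  obtain ⟨Q, hQ, hS₂⟩ : ∃ Q : Matrix (Fin n) (Fin n) ℂ,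
      Q.IsHermitian ∧ S₂.map Complex.ofReal = Complex.I • Q := by
    refine ⟨-Complex.I • S₂.map Complex.ofReal, ?_, by simp [smul_smul]⟩
    ext i j
    have h : S₂ j i = -S₂ i j := congrFun (congrFun hskew₂ i) j
    simp [h]
  have hkron : (S₁' ⊗ₖ S₂).map Complex.ofReal =
      Complex.I • (S₁'.map Complex.ofReal ⊗ₖ Q) := by
    rw [← kronecker_smul, ← hS₂]
    ext ⟨i, j⟩ ⟨k, l⟩
    simp
  have hS₁spec : spectrum ℂ (S₁.map Complex.ofReal) =
      spectrum ℂ (Complex.I • S₁'.map Complex.ofReal) := by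
    have h := spectrum_fromBlocks_neg_eq_spectrum_I_smul (A.map Complex.ofReal)
      (Aᵀ.map Complex.ofReal)
    convert h using 2
    · subst hS₁
      ext (i | i) (j | j) <;> simp
    · subst hS₁'
      ext (i | i) (j | j) <;> simp
  rw [hkron, hS₁spec, hS₂]
  ext z
  obtain ⟨w, rfl⟩ : ∃ w, z = Complex.I * w := ⟨-Complex.I * z, by simp [← mul_assoc]⟩
  simp only [Set.mem_ofPred_eq, spectrum.mem_I_smul_iff, hP.spectrum_kronecker hQ,
    hP.spectrum_eq_image_range, hQ.spectrum_eq_image_range, mul_assoc,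
    mul_right_inj' Complex.I_ne_zero]
  constructor
  · rintro ⟨⟨i, j⟩, rfl⟩
    exact ⟨_, _, rfl, ⟨_, ⟨i, rfl⟩, rfl⟩, ⟨_, ⟨j, rfl⟩, rfl⟩⟩
  · rintro ⟨μ, lam, rfl, ⟨_, ⟨i, rfl⟩, hi⟩, ⟨_, ⟨j, rfl⟩, hj⟩⟩
    exact ⟨(i, j), congrArg₂ (· * ·) hi hj⟩
end

section
/- Let A be a real m₁×m₂ matrix, m = m₁+m₂, set S₁ = [[0, A],[−Aᵀ, 0]], S₁' = [[0, A],[Aᵀ, 0]] and I' = [[I_{m₁}, 0],[0, −I_{m₂}]], and let S₂ be an n×n real skew-symmetric matrix. Put S̄ = I'⊗S₂ + S₁⊗I_n and S = S₁'⊗S₂. Then S̄·Sᵀ + S·S̄ᵀ = 0. -/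
open Matrix Kronecker

theorem cartesian_kronecker_cross_terms_vanish
    (m₁ m₂ n : ℕ) (A : Matrix (Fin m₁) (Fin m₂) ℝ)
    (S₂ : Matrix (Fin n) (Fin n) ℝ) (hskew₂ : S₂ᵀ = -S₂)
    (S₁ : Matrix (Fin m₁ ⊕ Fin m₂) (Fin m₁ ⊕ Fin m₂) ℝ)
    (hS₁ : S₁ = Matrix.fromBlocks 0 A (-Aᵀ) 0)
    (S₁' : Matrix (Fin m₁ ⊕ Fin m₂) (Fin m₁ ⊕ Fin m₂) ℝ)
    (hS₁' : S₁' = Matrix.fromBlocks 0 A Aᵀ 0)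
    (I' : Matrix (Fin m₁ ⊕ Fin m₂) (Fin m₁ ⊕ Fin m₂) ℝ)
    (hI' : I' = Matrix.fromBlocks 1 0 0 (-1))
    (Sbar S : Matrix ((Fin m₁ ⊕ Fin m₂) × Fin n) ((Fin m₁ ⊕ Fin m₂) × Fin n) ℝ)
    (hSbar : Sbar = I' ⊗ₖ S₂ + S₁ ⊗ₖ (1 : Matrix (Fin n) (Fin n) ℝ))
    (hS : S = S₁' ⊗ₖ S₂) :
    Sbar * Sᵀ + S * Sbarᵀ = 0 := by
  have hI'T : I'ᵀ = I' := by simp [hI', fromBlocks_transpose]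
  have hS₁T : S₁ᵀ = -S₁ := by simp [hS₁, fromBlocks_transpose, fromBlocks_neg]
  have hS₁'T : S₁'ᵀ = S₁' := by simp [hS₁', fromBlocks_transpose]
  have hIS : I' * S₁' + S₁' * I' = 0 := by
    simp [hI', hS₁', fromBlocks_multiply, fromBlocks_add]
  have hSS : S₁ * S₁' + S₁' * S₁ = 0 := by
    simp [hS₁, hS₁', fromBlocks_multiply, fromBlocks_add]
  have hneg₁ : ∀ B : Matrix (Fin m₁ ⊕ Fin m₂) (Fin m₁ ⊕ Fin m₂) ℝ,
      B ⊗ₖ (-S₂) = -(B ⊗ₖ S₂) := fun B => by ext; simp [kroneckerMap_apply]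
  have hneg₂ : (-S₁) ⊗ₖ (1 : Matrix (Fin n) (Fin n) ℝ) = -(S₁ ⊗ₖ 1) := by
    ext; simp [kroneckerMap_apply]
  have hST : Sᵀ = -S := by
    rw [hS, ← kroneckerMap_transpose, hS₁'T, hskew₂, hneg₁]
  have hSbarT : Sbarᵀ = -Sbar := by
    rw [hSbar, transpose_add, ← kroneckerMap_transpose, ← kroneckerMap_transpose, hI'T,
      hskew₂, hS₁T, transpose_one, hneg₁, hneg₂, neg_add]
  have hanti : Sbar * S + S * Sbar = 0 := by
    calc Sbar * S + S * Sbar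
        = (I' * S₁' + S₁' * I') ⊗ₖ (S₂ * S₂) + (S₁ * S₁' + S₁' * S₁) ⊗ₖ S₂ := by
          simp only [hSbar, hS, add_mul, mul_add, ← mul_kronecker_mul, one_mul, mul_one,
            add_kronecker]
          abel
      _ = 0 := by rw [hIS, hSS, zero_kronecker, zero_kronecker, add_zero]
  rw [hST, hSbarT, mul_neg, mul_neg, ← neg_add, hanti, neg_zero]
end

section
/- Let A be a real m₁×m₂ matrix, m = m₁+m₂, set S₁ = [[0, A],[−Aᵀ, 0]] and I' = [[I_{m₁}, 0],[0, −I_{m₂}]], and let S₂ be an n×n real skew-symmetric matrix. Then the matrix S̄ = I'⊗S₂ + S₁⊗I_n satisfies S̄·S̄ᵀ = −( I_m⊗(S₂)² + (S₁)²⊗I_n ). -/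
open Matrix Kronecker

theorem cartesian_orientation_gram
    (m₁ m₂ n : ℕ) (A : Matrix (Fin m₁) (Fin m₂) ℝ)
    (S₂ : Matrix (Fin n) (Fin n) ℝ) (hskew₂ : S₂ᵀ = -S₂)
    (S₁ : Matrix (Fin m₁ ⊕ Fin m₂) (Fin m₁ ⊕ Fin m₂) ℝ)
    (hS₁ : S₁ = Matrix.fromBlocks 0 A (-Aᵀ) 0)
    (I' : Matrix (Fin m₁ ⊕ Fin m₂) (Fin m₁ ⊕ Fin m₂) ℝ)
    (hI' : I' = Matrix.fromBlocks 1 0 0 (-1))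
    (Sbar : Matrix ((Fin m₁ ⊕ Fin m₂) × Fin n) ((Fin m₁ ⊕ Fin m₂) × Fin n) ℝ)
    (hSbar : Sbar = I' ⊗ₖ S₂ + S₁ ⊗ₖ (1 : Matrix (Fin n) (Fin n) ℝ)) :
    Sbar * Sbarᵀ =
      -((1 : Matrix (Fin m₁ ⊕ Fin m₂) (Fin m₁ ⊕ Fin m₂) ℝ) ⊗ₖ (S₂ * S₂) +
        (S₁ * S₁) ⊗ₖ (1 : Matrix (Fin n) (Fin n) ℝ)) := by
  have hI'T : I'ᵀ = I' := by simp [hI', fromBlocks_transpose]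
  have hS₁T : S₁ᵀ = -S₁ := by simp [hS₁, fromBlocks_transpose, fromBlocks_neg]
  have hI'sq : I' * I' = 1 := by simp [hI', fromBlocks_multiply]
  have hanti : I' * S₁ = -(S₁ * I') := by
    simp [hI', hS₁, fromBlocks_multiply, fromBlocks_neg]
  have hneg : Sbarᵀ = -Sbar := by
    rw [hSbar, transpose_add, ← kroneckerMap_transpose, ← kroneckerMap_transpose, hI'T, hS₁T,
      hskew₂, transpose_one]
    ext
    simp only [Matrix.add_apply, Matrix.neg_apply, kroneckerMap_apply]
    ring
  have hcross : (I' * S₁) ⊗ₖ S₂ = -((S₁ * I') ⊗ₖ S₂) := by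
    ext
    simp [hanti, kroneckerMap_apply]
  rw [hneg, mul_neg, hSbar, add_mul, mul_add, mul_add]
  simp only [← mul_kronecker_mul, mul_one, one_mul, hI'sq, hcross]
  abel
end

section
/- Let A be a real m₁×m₂ matrix, m = m₁+m₂, set S₁ = [[0, A],[−Aᵀ, 0]], S₁' = [[0, A],[Aᵀ, 0]] and I' = [[I_{m₁}, 0],[0, −I_{m₂}]], and let S₂ be an n×n real skew-symmetric matrix. Then the matrix Ŝ = I'⊗S₂ + S₁⊗I_n + S₁'⊗S₂ satisfies Ŝ·Ŝᵀ = ((S₁)² − I_m) ⊗ ((S₂)² − I_n) − I_{mn}. -/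
open Matrix Kronecker

theorem strong_product_orientation_gram
    (m₁ m₂ n : ℕ) (A : Matrix (Fin m₁) (Fin m₂) ℝ)
    (S₂ : Matrix (Fin n) (Fin n) ℝ) (hskew₂ : S₂ᵀ = -S₂)
    (S₁ : Matrix (Fin m₁ ⊕ Fin m₂) (Fin m₁ ⊕ Fin m₂) ℝ)
    (hS₁ : S₁ = Matrix.fromBlocks 0 A (-Aᵀ) 0)
    (S₁' : Matrix (Fin m₁ ⊕ Fin m₂) (Fin m₁ ⊕ Fin m₂) ℝ)
    (hS₁' : S₁' = Matrix.fromBlocks 0 A Aᵀ 0)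
    (I' : Matrix (Fin m₁ ⊕ Fin m₂) (Fin m₁ ⊕ Fin m₂) ℝ)
    (hI' : I' = Matrix.fromBlocks 1 0 0 (-1))
    (Shat : Matrix ((Fin m₁ ⊕ Fin m₂) × Fin n) ((Fin m₁ ⊕ Fin m₂) × Fin n) ℝ)
    (hShat : Shat = I' ⊗ₖ S₂ + S₁ ⊗ₖ (1 : Matrix (Fin n) (Fin n) ℝ) + S₁' ⊗ₖ S₂) :
    Shat * Shatᵀ =
      (S₁ * S₁ - 1) ⊗ₖ (S₂ * S₂ - 1) -
        (1 : Matrix ((Fin m₁ ⊕ Fin m₂) × Fin n) ((Fin m₁ ⊕ Fin m₂) × Fin n) ℝ) := by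
  have hsq : (I' + S₁') * (I' + S₁') = 1 - S₁ * S₁ := by
    subst hS₁ hS₁' hI'
    rw [← fromBlocks_one, sub_eq_add_neg]
    simp [-fromBlocks_one, fromBlocks_add, fromBlocks_multiply, fromBlocks_neg, add_comm]
  have hanti : (I' + S₁') * S₁ = -(S₁ * (I' + S₁')) := by
    subst hS₁ hS₁' hI'
    simp [fromBlocks_add, fromBlocks_multiply, fromBlocks_neg]
  have hsymm : (I' + S₁')ᵀ = I' + S₁' := by
    subst hS₁' hI'
    simp [fromBlocks_add, fromBlocks_transpose]
  have hskew₁ : S₁ᵀ = -S₁ := by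
    subst hS₁
    simp [fromBlocks_transpose, fromBlocks_neg]
  have hsum : Shat = (I' + S₁') ⊗ₖ S₂ + S₁ ⊗ₖ (1 : Matrix (Fin n) (Fin n) ℝ) := by
    rw [hShat, add_kronecker]
    abel
  have neg_left (X : Matrix (Fin m₁ ⊕ Fin m₂) (Fin m₁ ⊕ Fin m₂) ℝ)
      (Y : Matrix (Fin n) (Fin n) ℝ) : (-X) ⊗ₖ Y = -(X ⊗ₖ Y) := by
    ext; simp [kroneckerMap_apply]
  have neg_right (X : Matrix (Fin m₁ ⊕ Fin m₂) (Fin m₁ ⊕ Fin m₂) ℝ)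
      (Y : Matrix (Fin n) (Fin n) ℝ) : X ⊗ₖ (-Y) = -(X ⊗ₖ Y) := by
    ext; simp [kroneckerMap_apply]
  have hskew : Shatᵀ = -Shat := by
    rw [hsum, transpose_add, ← kroneckerMap_transpose, ← kroneckerMap_transpose, hsymm, hskew₁,
      hskew₂, transpose_one, neg_left, neg_right, neg_add]
  rw [hskew, hsum, mul_neg, add_mul, mul_add, mul_add]
  simp only [← mul_kronecker_mul, hsq, hanti, mul_one, one_mul]
  simp only [sub_eq_add_neg, add_kronecker, kronecker_add, neg_left, neg_right,
    one_kronecker_one]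
  abel
end

section
/- Let A be a real m₁×m₂ matrix, m = m₁+m₂, set S₁ = [[0, A],[−Aᵀ, 0]], S₁' = [[0, A],[Aᵀ, 0]] and I' = [[I_{m₁}, 0],[0, −I_{m₂}]], and let S₂ be an n×n real skew-symmetric matrix. Put Ŝ = I'⊗S₂ + S₁⊗I_n + S₁'⊗S₂. Then the real spectrum of Ŝ·Ŝᵀ equals the set { (α+1)(β+1) − 1 : α is a real eigenvalue of S₁S₁ᵀ and β is a real eigenvalue of S₂S₂ᵀ }. -/
open Matrix Kronecker

open scoped Pointwise in
/-- Adding a scalar to an element of an algebra translates its spectrum. -/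
theorem spectrum.add_algebraMap_eq_image {R B : Type*} [CommRing R] [Ring B] [Algebra R B]
    (b : B) (r : R) : spectrum R (b + algebraMap R B r) = (· + r) '' spectrum R b := by
  rw [← spectrum.add_singleton_eq, Set.add_singleton]

/-- The real spectrum of the Kronecker product of two real symmetric matrices is the pointwise
product of their spectra. -/
theorem Matrix.IsHermitian.spectrum_kronecker_s13 {ι κ : Type*} [Fintype ι] [DecidableEq ι]
    [Fintype κ] [DecidableEq κ] {X : Matrix ι ι ℝ} {Y : Matrix κ κ ℝ}
    (hX : X.IsHermitian) (hY : Y.IsHermitian) :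
    spectrum ℝ (X ⊗ₖ Y) = Set.image2 (· * ·) (spectrum ℝ X) (spectrum ℝ Y) := by
  let W : unitary (Matrix (ι × κ) (ι × κ) ℝ) :=
    ⟨_, kronecker_mem_unitary hX.eigenvectorUnitary.2 hY.eigenvectorUnitary.2⟩
  have hW : X ⊗ₖ Y = Unitary.conjStarAlgAut ℝ _ W
      (diagonal fun p : ι × κ => hX.eigenvalues p.1 * hY.eigenvalues p.2) := by
    conv_lhs => rw [hX.spectral_theorem, hY.spectral_theorem]
    simp only [Unitary.conjStarAlgAut_apply, mul_kronecker_mul, diagonal_kronecker_diagonal, W,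
      star_eq_conjTranspose, conjTranspose_kronecker]
    rfl
  rw [hW, AlgEquiv.spectrum_eq, spectrum_diagonal, hX.spectrum_real_eq_range_eigenvalues,
    hY.spectrum_real_eq_range_eigenvalues, Set.image2_range]

/-- The Gram matrix of the skew-adjacency matrix of an oriented strong product, shifted by the
identity, is a Kronecker product. -/
theorem strong_product_gram_eq {ι₁ ι₂ κ : Type*} [Fintype ι₁] [DecidableEq ι₁] [Fintype ι₂]
    [DecidableEq ι₂] [Fintype κ] [DecidableEq κ] (A : Matrix ι₁ ι₂ ℝ) {S : Matrix κ κ ℝ}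
    (hS : Sᵀ = -S) :
    (fromBlocks 1 0 0 (-1) ⊗ₖ S + fromBlocks 0 A (-Aᵀ) 0 ⊗ₖ (1 : Matrix κ κ ℝ) +
        fromBlocks 0 A Aᵀ 0 ⊗ₖ S) *
      (fromBlocks 1 0 0 (-1) ⊗ₖ S + fromBlocks 0 A (-Aᵀ) 0 ⊗ₖ (1 : Matrix κ κ ℝ) +
        fromBlocks 0 A Aᵀ 0 ⊗ₖ S)ᵀ =
      (fromBlocks 0 A (-Aᵀ) 0 * (fromBlocks 0 A (-Aᵀ) 0)ᵀ + 1) ⊗ₖ (S * Sᵀ + 1) - 1 := by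
  set J : Matrix (ι₁ ⊕ ι₂) (ι₁ ⊕ ι₂) ℝ := fromBlocks 1 0 0 (-1) with hJ
  set T : Matrix (ι₁ ⊕ ι₂) (ι₁ ⊕ ι₂) ℝ := fromBlocks 0 A (-Aᵀ) 0 with hT
  set T' : Matrix (ι₁ ⊕ ι₂) (ι₁ ⊕ ι₂) ℝ := fromBlocks 0 A Aᵀ 0 with hT'
  have hJt : Jᵀ = J := by simp [hJ, fromBlocks_transpose]
  have hTt : Tᵀ = -T := by simp [hT, fromBlocks_transpose, fromBlocks_neg]
  have hTt' : T'ᵀ = T' := by simp [hT', fromBlocks_transpose]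
  have hJJ : J * J = 1 := by simp [hJ, fromBlocks_multiply]
  have hJT : J * T = T' := by simp [hJ, hT, hT', fromBlocks_multiply]
  have hTJ : T * J = -T' := by simp [hJ, hT, hT', fromBlocks_multiply, fromBlocks_neg]
  have hJT' : J * T' = T := by simp [hJ, hT, hT', fromBlocks_multiply]
  have hTJ' : T' * J = -T := by simp [hJ, hT, hT', fromBlocks_multiply, fromBlocks_neg]
  have hTT' : T' * T = -(T * T') := by simp [hT, hT', fromBlocks_multiply, fromBlocks_neg]
  have hT'T' : T' * T' = -(T * T) := by simp [hT, hT', fromBlocks_multiply, fromBlocks_neg]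
  have neg_kronecker (B : Matrix (ι₁ ⊕ ι₂) (ι₁ ⊕ ι₂) ℝ) (C : Matrix κ κ ℝ) :
      (-B) ⊗ₖ C = -(B ⊗ₖ C) := by ext; simp
  have kronecker_neg (B : Matrix (ι₁ ⊕ ι₂) (ι₁ ⊕ ι₂) ℝ) (C : Matrix κ κ ℝ) :
      B ⊗ₖ (-C) = -(B ⊗ₖ C) := by ext; simp
  have kronecker_transpose (B : Matrix (ι₁ ⊕ ι₂) (ι₁ ⊕ ι₂) ℝ) (C : Matrix κ κ ℝ) :
      (B ⊗ₖ C)ᵀ = Bᵀ ⊗ₖ Cᵀ := rfl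
  simp only [transpose_add, kronecker_transpose, hJt, hTt, hTt', hS, transpose_one, mul_add,
    add_mul, ← mul_kronecker_mul, mul_neg, mul_one, one_mul, neg_kronecker, kronecker_neg, hJJ,
    hJT, hTJ, hJT', hTJ', hTT', hT'T', add_kronecker, kronecker_add, one_kronecker_one]
  abel

theorem strong_product_orientation_gram_spectrum
    (m₁ m₂ n : ℕ) (A : Matrix (Fin m₁) (Fin m₂) ℝ)
    (S₂ : Matrix (Fin n) (Fin n) ℝ) (hskew₂ : S₂ᵀ = -S₂)
    (S₁ : Matrix (Fin m₁ ⊕ Fin m₂) (Fin m₁ ⊕ Fin m₂) ℝ)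
    (hS₁ : S₁ = Matrix.fromBlocks 0 A (-Aᵀ) 0)
    (S₁' : Matrix (Fin m₁ ⊕ Fin m₂) (Fin m₁ ⊕ Fin m₂) ℝ)
    (hS₁' : S₁' = Matrix.fromBlocks 0 A Aᵀ 0)
    (I' : Matrix (Fin m₁ ⊕ Fin m₂) (Fin m₁ ⊕ Fin m₂) ℝ)
    (hI' : I' = Matrix.fromBlocks 1 0 0 (-1))
    (Shat : Matrix ((Fin m₁ ⊕ Fin m₂) × Fin n) ((Fin m₁ ⊕ Fin m₂) × Fin n) ℝ)
    (hShat : Shat = I' ⊗ₖ S₂ + S₁ ⊗ₖ (1 : Matrix (Fin n) (Fin n) ℝ) + S₁' ⊗ₖ S₂) :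
    spectrum ℝ (Shat * Shatᵀ) =
      {x : ℝ | ∃ α β : ℝ, α ∈ spectrum ℝ (S₁ * S₁ᵀ) ∧ β ∈ spectrum ℝ (S₂ * S₂ᵀ) ∧
        x = (α + 1) * (β + 1) - 1} := by
  subst hS₁ hS₁' hI' hShat
  set S₁ : Matrix (Fin m₁ ⊕ Fin m₂) (Fin m₁ ⊕ Fin m₂) ℝ := fromBlocks 0 A (-Aᵀ) 0
  have hP : (S₁ * S₁ᵀ + 1).IsHermitian :=
    (isHermitian_mul_conjTranspose_self S₁).add isHermitian_one
  have hQ : (S₂ * S₂ᵀ + 1).IsHermitian :=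
    (isHermitian_mul_conjTranspose_self S₂).add isHermitian_one
  have hP1 : spectrum ℝ (S₁ * S₁ᵀ + 1) = (· + 1) '' spectrum ℝ (S₁ * S₁ᵀ) := by
    rw [← spectrum.add_algebraMap_eq_image, map_one]
  have hQ1 : spectrum ℝ (S₂ * S₂ᵀ + 1) = (· + 1) '' spectrum ℝ (S₂ * S₂ᵀ) := by
    rw [← spectrum.add_algebraMap_eq_image, map_one]
  have hsub (M : Matrix ((Fin m₁ ⊕ Fin m₂) × Fin n) ((Fin m₁ ⊕ Fin m₂) × Fin n) ℝ) :
      spectrum ℝ (M - 1) = (· - 1) '' spectrum ℝ M := by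
    simpa [sub_eq_add_neg] using spectrum.add_algebraMap_eq_image M (-1 : ℝ)
  rw [strong_product_gram_eq A hskew₂, hsub, hP.spectrum_kronecker_s13 hQ, hP1, hQ1]
  ext x
  constructor
  · rintro ⟨_, ⟨_, ⟨α, hα, rfl⟩, _, ⟨β, hβ, rfl⟩, rfl⟩, rfl⟩
    exact ⟨α, β, hα, hβ, rfl⟩
  · rintro ⟨α, β, hα, hβ, rfl⟩
    exact ⟨_, ⟨_, ⟨α, hα, rfl⟩, _, ⟨β, hβ, rfl⟩, rfl⟩, rfl⟩
end

section
/- Let A be a real m₁×m₂ matrix, m = m₁+m₂, set S₁ = [[0, A],[−Aᵀ, 0]], S₁' = [[0, A],[Aᵀ, 0]] and I' = [[I_{m₁}, 0],[0, −I_{m₂}]], and let S₂ and S₃ be n×n real skew-symmetric matrices. Then the matrix S̃ = I'⊗S₂ + S₁⊗I_n + S₁'⊗S₃ satisfies S̃ᵀ·S̃ = −( I_m⊗(S₂)² + (S₁)²⊗I_n − (S₁)²⊗(S₃)² + S₁⊗(S₂S₃ − S₃S₂) ). -/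
open Matrix Kronecker

theorem neg_kronecker_eq {R l m n p : Type*} [Ring R] (X : Matrix l m R) (Y : Matrix n p R) :
    (-X) ⊗ₖ Y = -(X ⊗ₖ Y) := by
  ext; simp

theorem kronecker_neg_eq {R l m n p : Type*} [Ring R] (X : Matrix l m R) (Y : Matrix n p R) :
    X ⊗ₖ (-Y) = -(X ⊗ₖ Y) := by
  ext; simp

theorem lexicographic_orientation_gram
    (m₁ m₂ n : ℕ) (A : Matrix (Fin m₁) (Fin m₂) ℝ)
    (S₂ S₃ : Matrix (Fin n) (Fin n) ℝ)
    (hskew₂ : S₂ᵀ = -S₂) (hskew₃ : S₃ᵀ = -S₃)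
    (S₁ : Matrix (Fin m₁ ⊕ Fin m₂) (Fin m₁ ⊕ Fin m₂) ℝ)
    (hS₁ : S₁ = Matrix.fromBlocks 0 A (-Aᵀ) 0)
    (S₁' : Matrix (Fin m₁ ⊕ Fin m₂) (Fin m₁ ⊕ Fin m₂) ℝ)
    (hS₁' : S₁' = Matrix.fromBlocks 0 A Aᵀ 0)
    (I' : Matrix (Fin m₁ ⊕ Fin m₂) (Fin m₁ ⊕ Fin m₂) ℝ)
    (hI' : I' = Matrix.fromBlocks 1 0 0 (-1))
    (Stil : Matrix ((Fin m₁ ⊕ Fin m₂) × Fin n) ((Fin m₁ ⊕ Fin m₂) × Fin n) ℝ)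
    (hStil : Stil = I' ⊗ₖ S₂ + S₁ ⊗ₖ (1 : Matrix (Fin n) (Fin n) ℝ) + S₁' ⊗ₖ S₃) :
    Stilᵀ * Stil =
      -((1 : Matrix (Fin m₁ ⊕ Fin m₂) (Fin m₁ ⊕ Fin m₂) ℝ) ⊗ₖ (S₂ * S₂) +
        (S₁ * S₁) ⊗ₖ (1 : Matrix (Fin n) (Fin n) ℝ) -
        (S₁ * S₁) ⊗ₖ (S₃ * S₃) +
        S₁ ⊗ₖ (S₂ * S₃ - S₃ * S₂)) := by
  have hIS : I' * S₁ = S₁' := by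
    simp [hI', hS₁, hS₁', fromBlocks_multiply]
  have hSI : S₁ * I' = -S₁' := by
    simp [hI', hS₁, hS₁', fromBlocks_multiply, fromBlocks_neg]
  have hIS' : I' * S₁' = S₁ := by
    simp [hI', hS₁, hS₁', fromBlocks_multiply]
  have hSI' : S₁' * I' = -S₁ := by
    simp [hI', hS₁, hS₁', fromBlocks_multiply, fromBlocks_neg]
  have hII : I' * I' = 1 := by
    simp [hI', fromBlocks_multiply]
  have hSS : S₁' * S₁' = -(S₁ * S₁) := by
    simp [hS₁, hS₁', fromBlocks_multiply, fromBlocks_neg]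
  have hanti : S₁' * S₁ = -(S₁ * S₁') := by
    simp [hS₁, hS₁', fromBlocks_multiply, fromBlocks_neg]
  have hS₁t : S₁ᵀ = -S₁ := by
    simp [hS₁, fromBlocks_transpose, fromBlocks_neg]
  have hS₁t' : S₁'ᵀ = S₁' := by
    simp [hS₁', fromBlocks_transpose]
  have hIt : I'ᵀ = I' := by
    simp [hI', fromBlocks_transpose]
  have hskew : Stilᵀ = -Stil := by
    simp only [hStil, transpose_add, ← kroneckerMap_transpose, hskew₂, hskew₃, hS₁t, hS₁t', hIt,
      transpose_one, neg_kronecker_eq, kronecker_neg_eq]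
    abel
  rw [hskew, Matrix.neg_mul, hStil]
  simp only [Matrix.add_mul, Matrix.mul_add, ← mul_kronecker_mul, hIS, hSI, hIS', hSI', hII, hSS,
    hanti, Matrix.one_mul, Matrix.mul_one, sub_eq_add_neg, kronecker_add, neg_kronecker_eq, kronecker_neg_eq]
  abel
end
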